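/- For every u ∈ C¹(ℝ^d) with supp u ⊆ X, the restriction ũ = u|_X belongs to the domain of the infinitesimal generator G̃ of the semigroup (P̃^t)_{t≥0}, and G̃ũ = (−div(v u))|_X; that is, (P̃^t ũ − ũ)/t converges in L¹(X) to the restriction to X of −div(v u) as t → 0⁺. -/

import Mathlib

open MeasureTheory Filter Topology Set

open scoped Classical

/-- The Frobenius–Perron (transfer) operator of the outflow system:
`(FP φ X t u) x = u (φ (-t) x) * |det D (φ (-t)) x|` if the backward trajectory of `x`
stays in the interior of `X` during `[0, t]`, and `0` otherwise. -/
noncomputable def FP {d : ℕ} (φ : ℝ → (Fin d → ℝ) → (Fin d → ℝ)) (X : Set (Fin d → ℝ))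
    (t : ℝ) (u : (Fin d → ℝ) → ℝ) (x : Fin d → ℝ) : ℝ :=
  if ∀ s ∈ Set.Icc (0 : ℝ) t, φ (-s) x ∈ interior X then
    u (φ (-t) x) * |(fderiv ℝ (φ (-t)) x).det|
  else 0

/-- The setting: a compact state space `X ⊆ ℝ^d` with nonempty interior, a `C²` vector
field `v` admitting a global flow `φ` whose time-`t` maps are `C¹` diffeomorphisms. -/
structure FlowSetup (d : ℕ) where
  hd : 1 ≤ d
  X : Set (Fin d → ℝ)
  hXcomp : IsCompact X
  hXint : (interior X).Nonempty
  v : (Fin d → ℝ) → (Fin d → ℝ)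
  hv : ContDiff ℝ 2 v
  φ : ℝ → (Fin d → ℝ) → (Fin d → ℝ)
  flow_zero : ∀ x, φ 0 x = x
  flow_add : ∀ s t x, φ (s + t) x = φ s (φ t x)
  flow_smooth : ∀ t, ContDiff ℝ 1 (φ t)
  flow_deriv : ∀ x t, HasDerivAt (fun τ => φ τ x) (v (φ t x)) t

/-- `div (v u) x = ∑ i, ∂ᵢ (vᵢ u) (x)`. -/
noncomputable def divVU {d : ℕ} (v : (Fin d → ℝ) → (Fin d → ℝ)) (u : (Fin d → ℝ) → ℝ)
    (x : Fin d → ℝ) : ℝ :=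
  ∑ i : Fin d, fderiv ℝ (fun y => v y i * u y) x (Pi.single i 1)

/-- The inflow boundary `∂X⁻`: boundary points whose forward trajectory enters the
interior of `X` immediately. -/
def inflowBoundary {d : ℕ} (φ : ℝ → (Fin d → ℝ) → (Fin d → ℝ)) (X : Set (Fin d → ℝ)) :
    Set (Fin d → ℝ) :=
  {x | x ∈ frontier X ∧ ∃ ε > 0, ∀ s ∈ Set.Ioc (0 : ℝ) ε, φ s x ∈ interior X}

/-- The axis-aligned box with lower corner `a` and edge lengths `h`. -/
def coverBox {d : ℕ} (a h : Fin d → ℝ) : Set (Fin d → ℝ) :=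
  Set.univ.pi fun j => Set.Ico (a j) (a j + h j)

/-- A covering of `X` by finitely many pairwise disjoint congruent boxes, each of which
meets `X`. -/
structure BoxCover (d : ℕ) (X : Set (Fin d → ℝ)) where
  k : ℕ
  a : Fin k → Fin d → ℝ
  h : Fin d → ℝ
  h_pos : ∀ j, 0 < h j
  disj : ∀ i i', i ≠ i' → Disjoint (coverBox (a i) h) (coverBox (a i') h)
  covers : X ⊆ ⋃ i, coverBox (a i) h
  meets : ∀ i, (X ∩ coverBox (a i) h).Nonempty

/-- The `L²`-orthogonal projection `π_n` onto the space `V_n` of functions that are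
constant on each box of the covering and vanish outside it. -/
noncomputable def proj {d : ℕ} {X : Set (Fin d → ℝ)} (B : BoxCover d X)
    (u : (Fin d → ℝ) → ℝ) (x : Fin d → ℝ) : ℝ :=
  ∑ i : Fin B.k, Set.indicator (coverBox (B.a i) B.h)
    (fun _ => (∫ y in coverBox (B.a i) B.h, u y) / (volume (coverBox (B.a i) B.h)).toReal) x

/-- Membership in `V_n`: piecewise constant on the boxes of the covering, zero outside. -/
def memVn {d : ℕ} {X : Set (Fin d → ℝ)} (B : BoxCover d X) (w : (Fin d → ℝ) → ℝ) : Prop :=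
  ∃ c : Fin B.k → ℝ,
    w = fun x => ∑ i : Fin B.k, Set.indicator (coverBox (B.a i) B.h) (fun _ => c i) x


section CompactBase

variable {E F : Type*} [NormedAddCommGroup E] [NormedAddCommGroup F]

/-- A continuous map is uniformly continuous near a compact set, in filter form. -/
theorem tendsto_sub_of_isCompact {α : Type*} {l : Filter α} {f : E → F}
    (hf : Continuous f) {K : Set E} (hK : IsCompact K) {x y : α → E}
    (hx : ∀ᶠ a in l, x a ∈ K) (hxy : Tendsto (fun a => y a - x a) l (𝓝 0)) :
    Tendsto (fun a => f (y a) - f (x a)) l (𝓝 0) := by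
  refine Metric.tendsto_nhds.2 fun ε hε => ?_
  obtain ⟨δ, hδ, h⟩ := Metric.mem_uniformity_dist.1 <|
    hK.uniformContinuousAt_of_continuousAt f (fun x _ => hf.continuousAt)
      (Metric.dist_mem_uniformity hε)
  filter_upwards [hx, hxy (Metric.ball_mem_nhds 0 hδ)] with a ha hya
  have := h (a := x a) (b := y a) (by simpa [dist_eq_norm, norm_sub_rev] using hya) ha
  simpa [dist_eq_norm, norm_sub_rev] using this

/-- A continuous map is bounded along a filter whose base points stay in a compact set. -/
theorem isBigO_one_of_isCompact {α : Type*} {l : Filter α} {f : E → F}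
    (hf : Continuous f) {K : Set E} (hK : IsCompact K) {x : α → E}
    (hx : ∀ᶠ a in l, x a ∈ K) : (fun a => f (x a)) =O[l] fun _ => (1 : ℝ) := by
  obtain ⟨C, hC⟩ := hK.exists_bound_of_continuousOn hf.continuousOn
  exact Asymptotics.IsBigO.of_bound C (hx.mono fun a ha => by simpa using hC _ ha)

end CompactBase

section UniformTaylor

variable {E F : Type*} [NormedAddCommGroup E] [NormedSpace ℝ E]
  [NormedAddCommGroup F] [NormedSpace ℝ F]

/-- A `C¹` map is strictly differentiable, uniformly at the points of a compact set. -/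
theorem exists_forall_ball_norm_sub_sub_fderiv_le {f : E → F} (hf : ContDiff ℝ 1 f)
    {K : Set E} (hK : IsCompact K) {ε : ℝ} (hε : 0 < ε) :
    ∃ δ > 0, ∀ x ∈ K, ∀ y ∈ Metric.ball x δ, ∀ z ∈ Metric.ball x δ,
      ‖f y - f z - fderiv ℝ f x (y - z)‖ ≤ ε * ‖y - z‖ := by
  have hc : Continuous (fderiv ℝ f) := hf.continuous_fderiv one_ne_zero
  have h := hK.uniformContinuousAt_of_continuousAt (fderiv ℝ f)
    (fun x _ => hc.continuousAt) (Metric.dist_mem_uniformity hε)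
  obtain ⟨δ, hδ, h⟩ := Metric.mem_uniformity_dist.1 h
  refine ⟨δ, hδ, fun x hx y hy z hz => ?_⟩
  refine (convex_ball x δ).norm_image_sub_le_of_norm_hasFDerivWithin_le'
    (f' := fderiv ℝ f) (fun q _ => ?_) (fun q hq => ?_) hz hy
  · exact ((hf.differentiable one_ne_zero) q).hasFDerivAt.hasFDerivWithinAt
  · have := h (a := x) (b := q) (by rwa [dist_comm]) hx
    rw [← dist_eq_norm, dist_comm]
    exact le_of_lt this

/-- First-order Taylor expansion of a `C¹` map at base points varying in a compact set. -/
theorem isLittleO_sub_sub_fderiv_of_isCompact {α : Type*} {l : Filter α} {f : E → F}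
    (hf : ContDiff ℝ 1 f) {K : Set E} (hK : IsCompact K) {x y : α → E}
    (hx : ∀ᶠ a in l, x a ∈ K) (hxy : Tendsto (fun a => y a - x a) l (𝓝 0)) :
    (fun a => f (y a) - f (x a) - fderiv ℝ f (x a) (y a - x a)) =o[l] fun a => y a - x a := by
  refine Asymptotics.isLittleO_iff.2 fun ε hε => ?_
  obtain ⟨δ, hδ, h⟩ := exists_forall_ball_norm_sub_sub_fderiv_le hf hK hε
  filter_upwards [hx, hxy (Metric.ball_mem_nhds 0 hδ)] with a ha hya
  refine h _ ha _ ?_ _ (Metric.mem_ball_self hδ)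
  simpa [dist_eq_norm] using hya

end UniformTaylor

section Flow

variable {E : Type*} [NormedAddCommGroup E] [NormedSpace ℝ E] {w : E → E} {ψ : ℝ → E → E}

/-- Short trajectories starting in a bounded set move with bounded speed. -/
theorem exists_norm_flow_sub_le [ProperSpace E] (hw : Continuous w) (h0 : ∀ x, ψ 0 x = x)
    (hψ : ∀ x t, HasDerivAt (fun τ => ψ τ x) (w (ψ t x)) t) (R : ℝ) :
    ∃ C > 0, ∃ τ > 0, ∀ x ∈ Metric.closedBall (0 : E) R, ∀ t ∈ Icc 0 τ,
      ‖ψ t x - x‖ ≤ C * t := by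
  obtain ⟨M, hM⟩ :=
    (isCompact_closedBall (0 : E) (R + 1)).exists_bound_of_continuousOn hw.continuousOn
  have hC : 0 < |M| + 1 := by positivity
  refine ⟨|M| + 1, hC, 1 / (|M| + 1), by positivity, fun x hx => ?_⟩
  refine image_norm_le_of_norm_deriv_right_lt_deriv_boundary (f := fun t => ψ t x - x)
    (f' := fun t => w (ψ t x)) (B' := fun _ => |M| + 1)
    (fun t _ => ((hψ x t).sub_const x).continuousAt.continuousWithinAt)
    (fun t _ => ((hψ x t).sub_const x).hasDerivWithinAt) (by simp [h0])
    (fun t => by simpa using (hasDerivAt_id t).const_mul (|M| + 1)) fun t ht hB => ?_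
  have h1 : (|M| + 1) * t ≤ 1 := by
    have := (lt_div_iff₀ hC).1 ht.2
    linarith
  have : ψ t x ∈ Metric.closedBall (0 : E) (R + 1) := by
    rw [mem_closedBall_zero_iff] at hx ⊢
    calc ‖ψ t x‖ = ‖(ψ t x - x) + x‖ := by simp
      _ ≤ ‖ψ t x - x‖ + ‖x‖ := norm_add_le _ _
      _ ≤ R + 1 := by linarith
  linarith [hM _ this, le_abs_self M]

/-- If `a' = B a` up to an error `ε ‖a‖`, then `a t` is `a 0 + t • B (a 0)` up to an error
`O(ε t + t²) ‖a 0‖`. -/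
theorem norm_sub_sub_smul_le_of_deriv_approx {a a' : ℝ → E} {B : E →L[ℝ] E} {L ε t : ℝ}
    (ht : 0 ≤ t) (hB : ‖B‖ ≤ L) (hε0 : 0 ≤ ε) (hε : ε ≤ 1) (htL : (L + 1) * t ≤ 1)
    (ha : ∀ s ∈ Icc 0 t, HasDerivAt a (a' s) s)
    (hb : ∀ s ∈ Icc 0 t, ‖a' s - B (a s)‖ ≤ ε * ‖a s‖) :
    ‖a t - a 0 - t • B (a 0)‖ ≤ (3 * ε + L * (3 * (L + 1) * t)) * ‖a 0‖ * t := by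
  have hL : 0 ≤ L := (norm_nonneg B).trans hB
  have hBv : ∀ z, ‖B z‖ ≤ L * ‖z‖ := fun z => B.le_of_opNorm_le hB z
  have ha' : ∀ s ∈ Icc 0 t, ‖a' s‖ ≤ (L + 1) * ‖a s‖ := fun s hs => by
    calc ‖a' s‖ = ‖(a' s - B (a s)) + B (a s)‖ := by simp
      _ ≤ ε * ‖a s‖ + L * ‖a s‖ := norm_add_le_of_le (hb s hs) (hBv _)
      _ ≤ (L + 1) * ‖a s‖ := by nlinarith [norm_nonneg (a s)]
  have hcont : ContinuousOn a (Icc 0 t) := fun s hs => (ha s hs).continuousAt.continuousWithinAt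
  have hG : ∀ s ∈ Icc 0 t, ‖a s‖ ≤ 3 * ‖a 0‖ := fun s hs => by
    have := norm_le_gronwallBound_of_norm_deriv_right_le (f := a) (f' := a') (δ := ‖a 0‖)
      (K := L + 1) (ε := 0) hcont
      (fun s hs => (ha s (Ico_subset_Icc_self hs)).hasDerivWithinAt) le_rfl
      (fun s hs => by simpa using ha' s (Ico_subset_Icc_self hs)) s hs
    rw [gronwallBound_ε0, sub_zero] at this
    have h3 : Real.exp ((L + 1) * s) ≤ 3 :=
      (Real.exp_le_exp.2 ((mul_le_mul_of_nonneg_left hs.2 (by linarith)).trans htL)).trans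
        (Real.exp_one_lt_d9.le.trans (by norm_num))
    nlinarith [norm_nonneg (a 0)]
  have hD : ∀ s ∈ Icc 0 t, ‖a s - a 0‖ ≤ 3 * (L + 1) * t * ‖a 0‖ := fun s hs => by
    have := norm_image_sub_le_of_norm_deriv_right_le_segment (f := a) (f' := a')
      (C := (L + 1) * (3 * ‖a 0‖)) hcont
      (fun s hs => (ha s (Ico_subset_Icc_self hs)).hasDerivWithinAt)
      (fun s hs => (ha' s (Ico_subset_Icc_self hs)).trans
        (mul_le_mul_of_nonneg_left (hG s (Ico_subset_Icc_self hs)) (by linarith))) s hs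
    calc ‖a s - a 0‖ ≤ (L + 1) * (3 * ‖a 0‖) * (s - 0) := this
      _ ≤ (L + 1) * (3 * ‖a 0‖) * t := by
        refine mul_le_mul_of_nonneg_left (by linarith [hs.2]) (by positivity)
      _ = _ := by ring
  have hder : ∀ s ∈ Icc 0 t, HasDerivAt (fun s => a s - a 0 - s • B (a 0))
      (a' s - B (a 0)) s := fun s hs => by
    simpa using ((ha s hs).sub_const (a 0)).fun_sub ((hasDerivAt_id s).smul_const (B (a 0)))
  have := norm_image_sub_le_of_norm_deriv_right_le_segment
    (f := fun s => a s - a 0 - s • B (a 0)) (f' := fun s => a' s - B (a 0))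
    (C := (3 * ε + L * (3 * (L + 1) * t)) * ‖a 0‖)
    (fun s hs => (hder s hs).continuousAt.continuousWithinAt)
    (fun s hs => (hder s (Ico_subset_Icc_self hs)).hasDerivWithinAt)
    (fun s hs => by
      have hs := Ico_subset_Icc_self hs
      calc ‖a' s - B (a 0)‖ = ‖(a' s - B (a s)) + B (a s - a 0)‖ := by simp
        _ ≤ ε * (3 * ‖a 0‖) + L * (3 * (L + 1) * t * ‖a 0‖) :=
          norm_add_le_of_le ((hb s hs).trans (mul_le_mul_of_nonneg_left (hG s hs) hε0))
            ((hBv _).trans (mul_le_mul_of_nonneg_left (hD s hs) hL))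
        _ = _ := by ring) t ⟨ht, le_rfl⟩
  simpa using this

variable [ProperSpace E] {K : Set E}

/-- `ψ t x - x → 0` as `t → 0⁺`, at linear speed and uniformly on compact sets. -/
theorem eventually_norm_flow_sub_le (hw : Continuous w) (h0 : ∀ x, ψ 0 x = x)
    (hψ : ∀ x t, HasDerivAt (fun τ => ψ τ x) (w (ψ t x)) t) (hK : IsCompact K) :
    ∃ C > 0, ∀ᶠ p : ℝ × E in 𝓝[>] 0 ×ˢ 𝓟 K, ∀ s ∈ Icc 0 p.1, ‖ψ s p.2 - p.2‖ ≤ C * p.1 := by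
  obtain ⟨R, hR⟩ := hK.isBounded.subset_closedBall 0
  obtain ⟨C, hC, τ, hτ, h⟩ := exists_norm_flow_sub_le hw h0 hψ R
  refine ⟨C, hC, eventually_prod_principal_iff.2 ?_⟩
  filter_upwards [Ioc_mem_nhdsGT hτ] with t ht x hx s hs
  exact (h x (hR hx) s ⟨hs.1, hs.2.trans ht.2⟩).trans (mul_le_mul_of_nonneg_left hs.2 hC.le)

/-- First-order expansion of the spatial derivative of a flow, uniformly on compact sets. -/
theorem isLittleO_fderiv_flow (hw : ContDiff ℝ 1 w) (h0 : ∀ x, ψ 0 x = x)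
    (hψ : ∀ x t, HasDerivAt (fun τ => ψ τ x) (w (ψ t x)) t)
    (hd : ∀ t, Differentiable ℝ (ψ t)) (hK : IsCompact K) :
    (fun p : ℝ × E => fderiv ℝ (ψ p.1) p.2 - 1 - p.1 • fderiv ℝ w p.2)
      =o[𝓝[>] 0 ×ˢ 𝓟 K] fun p => p.1 := by
  refine Asymptotics.isLittleO_iff.2 fun η hη => eventually_prod_principal_iff.2 ?_
  obtain ⟨R, hR⟩ := hK.isBounded.subset_closedBall 0
  obtain ⟨C, hC, τ, hτ, hflow⟩ := exists_norm_flow_sub_le hw.continuous h0 hψ (R + 1)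
  obtain ⟨L, hL⟩ := hK.exists_bound_of_continuousOn
    (hw.continuous_fderiv one_ne_zero).continuousOn
  set ε : ℝ := min 1 (η / 6)
  have hε : 0 < ε := by positivity
  have hε6 : ε ≤ η / 6 := min_le_right _ _
  obtain ⟨δ, hδ, happ⟩ := exists_forall_ball_norm_sub_sub_fderiv_le hw hK hε
  have e1 : ∀ᶠ t : ℝ in 𝓝[>] 0, (|L| + 1) * t ≤ 1 := by
    have : Tendsto (fun t : ℝ => (|L| + 1) * t) (𝓝[>] 0) (𝓝 0) :=
      ((by fun_prop : Continuous fun t : ℝ => (|L| + 1) * t).tendsto' 0 0 (by simp)).mono_left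
        nhdsWithin_le_nhds
    exact (this.eventually_lt_const one_pos).mono fun _ h => h.le
  have e2 : ∀ᶠ t : ℝ in 𝓝[>] 0, |L| * (3 * (|L| + 1) * t) ≤ η / 2 := by
    have : Tendsto (fun t : ℝ => |L| * (3 * (|L| + 1) * t)) (𝓝[>] 0) (𝓝 0) :=
      ((by fun_prop : Continuous fun t : ℝ => |L| * (3 * (|L| + 1) * t)).tendsto' 0 0
        (by simp)).mono_left nhdsWithin_le_nhds
    exact (this.eventually_lt_const (half_pos hη)).mono fun _ h => h.le
  have e3 : ∀ᶠ t : ℝ in 𝓝[>] 0, C * t < δ / 2 := by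
    have : Tendsto (fun t : ℝ => C * t) (𝓝[>] 0) (𝓝 0) :=
      ((by fun_prop : Continuous fun t : ℝ => C * t).tendsto' 0 0 (by simp)).mono_left
        nhdsWithin_le_nhds
    exact this.eventually_lt_const (half_pos hδ)
  filter_upwards [e1, e2, e3, Ioc_mem_nhdsGT hτ] with t h1 h2 h3 ht x hx
  have hball : ∀ y ∈ Metric.ball x (min 1 (δ / 2)), ∀ s ∈ Icc 0 t, ψ s y ∈ Metric.ball x δ := by
    intro y hy s hs
    have hyx : ‖y - x‖ < min 1 (δ / 2) := by simpa [dist_eq_norm] using hy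
    have hx' := hR hx
    have hyR : y ∈ Metric.closedBall (0 : E) (R + 1) := by
      rw [mem_closedBall_zero_iff] at hx' ⊢
      have := norm_le_norm_add_norm_sub x y
      rw [norm_sub_rev] at this
      linarith [hyx.trans_le (min_le_left _ _)]
    rw [mem_ball_iff_norm]
    have := hflow y hyR s ⟨hs.1, hs.2.trans ht.2⟩
    calc ‖ψ s y - x‖ ≤ ‖ψ s y - y‖ + ‖y - x‖ := norm_sub_le_norm_sub_add_norm_sub _ _ _
      _ < δ := by
        linarith [hyx.trans_le (min_le_right _ _), mul_le_mul_of_nonneg_left hs.2 hC.le]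
  have hr : 0 < min 1 (δ / 2) := by positivity
  have hder : HasFDerivAt (fun y => ψ t y - y - t • fderiv ℝ w x y)
      (fderiv ℝ (ψ t) x - 1 - t • fderiv ℝ w x) x :=
    (((hd t) x).hasFDerivAt.sub (hasFDerivAt_id x)).sub
      ((fderiv ℝ w x).hasFDerivAt.const_smul t)
  rw [Real.norm_of_nonneg ht.1.le]
  refine hder.le_of_lip' (by have := ht.1; positivity) ?_
  filter_upwards [Metric.ball_mem_nhds x hr] with y hy
  have key := norm_sub_sub_smul_le_of_deriv_approx (a := fun s => ψ s y - ψ s x)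
    (a' := fun s => w (ψ s y) - w (ψ s x)) (B := fderiv ℝ w x) ht.1.le
    ((hL x hx).trans (le_abs_self L)) hε.le (min_le_left _ _) h1
    (fun s _ => (hψ y s).sub (hψ x s))
    (fun s hs => happ x hx _ (hball y hy s hs) _ (hball x (Metric.mem_ball_self hr) s hs))
  simp only [h0] at key
  calc ‖ψ t y - y - t • fderiv ℝ w x y - (ψ t x - x - t • fderiv ℝ w x x)‖
      = ‖ψ t y - ψ t x - (y - x) - t • fderiv ℝ w x (y - x)‖ := by
        rw [map_sub, smul_sub]; congr 1; abel
    _ ≤ _ := key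
    _ ≤ η * ‖y - x‖ * t := by
        refine mul_le_mul_of_nonneg_right ?_ ht.1.le
        exact mul_le_mul_of_nonneg_right (by linarith) (norm_nonneg _)
    _ = η * t * ‖y - x‖ := by ring

/-- First-order expansion of a flow in time, uniformly on compact sets. -/
theorem isLittleO_flow (hw : Continuous w) (h0 : ∀ x, ψ 0 x = x)
    (hψ : ∀ x t, HasDerivAt (fun τ => ψ τ x) (w (ψ t x)) t) (hK : IsCompact K) :
    (fun p : ℝ × E => ψ p.1 p.2 - p.2 - p.1 • w p.2) =o[𝓝[>] 0 ×ˢ 𝓟 K] fun p => p.1 := by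
  refine Asymptotics.isLittleO_iff.2 fun ε hε => ?_
  obtain ⟨C, hC, h⟩ := eventually_norm_flow_sub_le hw h0 hψ hK
  obtain ⟨δ, hδ, hu⟩ := Metric.mem_uniformity_dist.1 <|
    hK.uniformContinuousAt_of_continuousAt w (fun x _ => hw.continuousAt)
      (Metric.dist_mem_uniformity hε)
  have e3 : ∀ᶠ t : ℝ in 𝓝[>] 0, C * t < δ := by
    have : Tendsto (fun t : ℝ => C * t) (𝓝[>] 0) (𝓝 0) :=
      ((by fun_prop : Continuous fun t : ℝ => C * t).tendsto' 0 0 (by simp)).mono_left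
        nhdsWithin_le_nhds
    exact this.eventually_lt_const hδ
  filter_upwards [h, e3.prod_inl _, (eventually_mem_nhdsWithin (s := Ioi (0 : ℝ))).prod_inl _,
    (eventually_prod_principal_iff (p := fun p : ℝ × E => p.2 ∈ K)).2
      (Eventually.of_forall fun _ _ hx => hx)] with ⟨t, x⟩ h1 h2 h3 hx
  simp only [mem_Ioi] at h1 h2 h3 hx
  have hder : ∀ s, HasDerivAt (fun s => ψ s x - s • w x) (w (ψ s x) - w x) s := fun s => by
    simpa using (hψ x s).fun_sub ((hasDerivAt_id s).smul_const (w x))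
  have := norm_image_sub_le_of_norm_deriv_right_le_segment
    (f := fun s => ψ s x - s • w x) (f' := fun s => w (ψ s x) - w x) (C := ε) (a := 0) (b := t)
    (fun s hs => (hder s).continuousAt.continuousWithinAt)
    (fun s hs => (hder s).hasDerivWithinAt)
    (fun s hs => by
      have := hu (a := x) (b := ψ s x) (by
        rw [dist_comm, dist_eq_norm]
        exact (h1 s (Ico_subset_Icc_self hs)).trans_lt h2) hx
      rw [← dist_eq_norm, dist_comm]
      exact le_of_lt this) t ⟨h3.le, le_rfl⟩
  rw [Real.norm_of_nonneg h3.le]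
  convert this using 2
  · simp only [h0, zero_smul, sub_zero]; abel
  · simp

end Flow

section Determinant

variable {d : ℕ}

theorem differentiable_continuousLinearMap_det :
    Differentiable ℝ fun A : (Fin d → ℝ) →L[ℝ] (Fin d → ℝ) => A.det := by
  have : (fun A : (Fin d → ℝ) →L[ℝ] (Fin d → ℝ) => A.det) =
      fun A => ∑ σ : Equiv.Perm (Fin d), ((Equiv.Perm.sign σ : ℤ) : ℝ) *
        ∏ i, A (Pi.single i 1) (σ i) := by
    ext A
    rw [ContinuousLinearMap.det, ← LinearMap.det_toMatrix', Matrix.det_apply']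
    simp [LinearMap.toMatrix'_apply]
  rw [this]
  fun_prop

/-- The derivative of the determinant at the identity is the trace. -/
theorem isLittleO_det_one_add :
    (fun H : (Fin d → ℝ) →L[ℝ] (Fin d → ℝ) =>
      (1 + H).det - 1 - LinearMap.trace ℝ _ (H : (Fin d → ℝ) →ₗ[ℝ] (Fin d → ℝ)))
      =o[𝓝 0] fun H => H := by
  have hD := (differentiable_continuousLinearMap_det (d := d) 1).hasFDerivAt
  have htr : ∀ H : (Fin d → ℝ) →L[ℝ] (Fin d → ℝ),
      fderiv ℝ (fun A : (Fin d → ℝ) →L[ℝ] (Fin d → ℝ) => A.det) 1 H =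
        LinearMap.trace ℝ _ (H : (Fin d → ℝ) →ₗ[ℝ] (Fin d → ℝ)) := fun H => by
    have h1 : HasDerivAt (fun r : ℝ => (1 + r • H).det)
        (fderiv ℝ (fun A : (Fin d → ℝ) →L[ℝ] (Fin d → ℝ) => A.det) 1 H) 0 := by
      have hl : HasDerivAt (fun r : ℝ => (1 : (Fin d → ℝ) →L[ℝ] (Fin d → ℝ)) + r • H) H 0 := by
        simpa using ((hasDerivAt_id (0 : ℝ)).smul_const H).const_add 1
      have hD' := hD
      rw [show (1 : (Fin d → ℝ) →L[ℝ] (Fin d → ℝ)) = 1 + (0 : ℝ) • H by simp] at hD'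
      simpa [Function.comp_def] using hD'.comp_hasDerivAt 0 hl
    set M := LinearMap.toMatrix' (H : (Fin d → ℝ) →ₗ[ℝ] (Fin d → ℝ)) with hM
    have h2 : HasDerivAt (fun r : ℝ => (1 + r • H).det) M.trace 0 := by
      set q := (Matrix.det (1 + (Polynomial.X : Polynomial ℝ) • M.map Polynomial.C)).divX.divX
        with hq
      have hdet : (fun r : ℝ => ((1 : (Fin d → ℝ) →L[ℝ] (Fin d → ℝ)) + r • H).det) =
          fun r => 1 + M.trace * r + q.eval r * r ^ 2 := funext fun r => by
        rw [hq, ← Matrix.det_one_add_smul, ContinuousLinearMap.det, ← LinearMap.det_toMatrix', hM]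
        congr 1
        simp
      rw [hdet]
      simpa using (((hasDerivAt_id (0 : ℝ)).const_mul M.trace).const_add 1).fun_add
        ((q.hasDerivAt 0).fun_mul ((hasDerivAt_id (0 : ℝ)).fun_pow 2))
    rw [h1.unique h2, hM, LinearMap.trace_eq_matrix_trace ℝ (Pi.basisFun ℝ (Fin d))]
    rfl
  have := hasFDerivAt_iff_isLittleO_nhds_zero.1 hD
  refine this.congr_left fun H => ?_
  rw [htr]
  congr 2
  simp [ContinuousLinearMap.det]

/-- The product rule `div (v u) = u div v + Du(v)`. -/
theorem divVU_eq {v : (Fin d → ℝ) → (Fin d → ℝ)} {u : (Fin d → ℝ) → ℝ}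
    {x : Fin d → ℝ} (hv : DifferentiableAt ℝ v x) (hu : DifferentiableAt ℝ u x) :
    divVU v u x = u x * LinearMap.trace ℝ _ (fderiv ℝ v x : (Fin d → ℝ) →ₗ[ℝ] (Fin d → ℝ)) +
      fderiv ℝ u x (v x) := by
  have hvi : ∀ i, HasFDerivAt (fun y => v y i)
      ((ContinuousLinearMap.proj i : (Fin d → ℝ) →L[ℝ] ℝ).comp (fderiv ℝ v x)) x := fun i =>
    (ContinuousLinearMap.proj i : (Fin d → ℝ) →L[ℝ] ℝ).hasFDerivAt.comp x hv.hasFDerivAt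
  have htr : LinearMap.trace ℝ _ (fderiv ℝ v x : (Fin d → ℝ) →ₗ[ℝ] (Fin d → ℝ)) =
      ∑ i, fderiv ℝ v x (Pi.single i 1) i := by
    rw [LinearMap.trace_eq_matrix_trace ℝ (Pi.basisFun ℝ (Fin d))]
    simp [Matrix.trace]
  have hux : fderiv ℝ u x (v x) = ∑ i, v x i * fderiv ℝ u x (Pi.single i 1) := by
    conv_lhs => rw [← Finset.univ_sum_single (v x), map_sum]
    refine Finset.sum_congr rfl fun i _ => ?_
    rw [← smul_eq_mul, ← map_smul, ← Pi.single_smul, smul_eq_mul, mul_one]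
  rw [divVU, htr, hux, Finset.mul_sum, ← Finset.sum_add_distrib]
  refine Finset.sum_congr rfl fun i _ => ?_
  rw [((hvi i).fun_mul hu.hasFDerivAt).fderiv]
  simp
  ring

end Determinant

section Transport

variable {d : ℕ} {w : (Fin d → ℝ) → (Fin d → ℝ)} {ψ : ℝ → (Fin d → ℝ) → (Fin d → ℝ)}
  {u : (Fin d → ℝ) → ℝ} {K : Set (Fin d → ℝ)}

/-- The trace of a continuous linear endomorphism as a continuous linear functional. -/
noncomputable def traceCLM (d : ℕ) : ((Fin d → ℝ) →L[ℝ] (Fin d → ℝ)) →L[ℝ] ℝ :=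
  LinearMap.toContinuousLinearMap
    (LinearMap.trace ℝ (Fin d → ℝ) ∘ₗ ContinuousLinearMap.coeLM ℝ)

theorem traceCLM_apply (A : (Fin d → ℝ) →L[ℝ] (Fin d → ℝ)) :
    traceCLM d A = LinearMap.trace ℝ _ (A : (Fin d → ℝ) →ₗ[ℝ] (Fin d → ℝ)) := rfl

theorem tendsto_fst_nhdsGT_prod_principal {E : Type*} (K : Set E) :
    Tendsto (fun p : ℝ × E => p.1) (𝓝[>] 0 ×ˢ 𝓟 K) (𝓝 0) :=
  tendsto_fst.mono_right nhdsWithin_le_nhds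

theorem eventually_snd_mem_prod_principal {E : Type*} (l : Filter ℝ) (K : Set E) :
    ∀ᶠ p : ℝ × E in l ×ˢ 𝓟 K, p.2 ∈ K :=
  eventually_prod_principal_iff.2 (Eventually.of_forall fun _ _ hx => hx)

/-- The Jacobian determinant of a flow is `1 + t tr Dw + o(t)`, uniformly on compact sets. -/
theorem isLittleO_det_fderiv_flow (hw : ContDiff ℝ 1 w) (h0 : ∀ x, ψ 0 x = x)
    (hψ : ∀ x t, HasDerivAt (fun τ => ψ τ x) (w (ψ t x)) t)
    (hd : ∀ t, Differentiable ℝ (ψ t)) (hK : IsCompact K) :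
    (fun p : ℝ × (Fin d → ℝ) =>
      (fderiv ℝ (ψ p.1) p.2).det - 1 - p.1 * traceCLM d (fderiv ℝ w p.2))
      =o[𝓝[>] 0 ×ˢ 𝓟 K] fun p => p.1 := by
  set l : Filter (ℝ × (Fin d → ℝ)) := 𝓝[>] 0 ×ˢ 𝓟 K
  have hH := isLittleO_fderiv_flow hw h0 hψ hd hK
  have hDw : (fun p : ℝ × (Fin d → ℝ) => fderiv ℝ w p.2) =O[l] fun _ => (1 : ℝ) :=
    isBigO_one_of_isCompact (hw.continuous_fderiv one_ne_zero) hK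
      (eventually_snd_mem_prod_principal _ K)
  have hHO : (fun p : ℝ × (Fin d → ℝ) => fderiv ℝ (ψ p.1) p.2 - 1) =O[l] fun p => p.1 := by
    have := (Asymptotics.isBigO_refl (fun p : ℝ × (Fin d → ℝ) => p.1) l).smul hDw
    simp only [smul_eq_mul, mul_one] at this
    simpa using hH.isBigO.add this
  have hH0 := hHO.trans_tendsto (tendsto_fst_nhdsGT_prod_principal K)
  have h1 := (isLittleO_det_one_add.comp_tendsto hH0).trans_isBigO hHO
  have h2 := ((traceCLM d).isBigO_comp _ l).trans_isLittleO hH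
  refine (h1.add h2).congr_left fun p => ?_
  simp only [Function.comp_def, ← traceCLM_apply, map_sub, map_smul, smul_eq_mul,
    add_sub_cancel]
  ring

/-- First-order expansion in time of a density transported by a flow, without outflow. -/
theorem isLittleO_transport (hw : ContDiff ℝ 1 w) (h0 : ∀ x, ψ 0 x = x)
    (hψ : ∀ x t, HasDerivAt (fun τ => ψ τ x) (w (ψ t x)) t)
    (hd : ∀ t, Differentiable ℝ (ψ t)) (hK : IsCompact K) (hu : ContDiff ℝ 1 u) :
    (fun p : ℝ × (Fin d → ℝ) => u (ψ p.1 p.2) * |(fderiv ℝ (ψ p.1) p.2).det| - u p.2 -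
      p.1 * divVU w u p.2) =o[𝓝[>] 0 ×ˢ 𝓟 K] fun p => p.1 := by
  have hxK := eventually_snd_mem_prod_principal (𝓝[>] (0 : ℝ)) K
  have ht0 := tendsto_fst_nhdsGT_prod_principal K
  have hJ := isLittleO_det_fderiv_flow hw h0 hψ hd hK
  have hy := isLittleO_flow hw.continuous h0 hψ hK
  set l : Filter (ℝ × (Fin d → ℝ)) := 𝓝[>] 0 ×ˢ 𝓟 K
  have htO := Asymptotics.isBigO_refl (fun p : ℝ × (Fin d → ℝ) => p.1) l
  have hwO : (fun p : ℝ × (Fin d → ℝ) => w p.2) =O[l] fun _ => (1 : ℝ) :=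
    isBigO_one_of_isCompact hw.continuous hK hxK
  have huO : (fun p : ℝ × (Fin d → ℝ) => u p.2) =O[l] fun _ => (1 : ℝ) :=
    isBigO_one_of_isCompact hu.continuous hK hxK
  have hDuO : (fun p : ℝ × (Fin d → ℝ) => fderiv ℝ u p.2) =O[l] fun _ => (1 : ℝ) :=
    isBigO_one_of_isCompact (hu.continuous_fderiv one_ne_zero) hK hxK
  have hDuwO : (fun p : ℝ × (Fin d → ℝ) => fderiv ℝ u p.2 (w p.2)) =O[l] fun _ => (1 : ℝ) :=
    isBigO_one_of_isCompact (f := fun x => fderiv ℝ u x (w x))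
      ((hu.continuous_fderiv one_ne_zero).clm_apply hw.continuous) hK hxK
  have htrO : (fun p : ℝ × (Fin d → ℝ) => traceCLM d (fderiv ℝ w p.2)) =O[l]
      fun _ => (1 : ℝ) :=
    isBigO_one_of_isCompact (f := fun x => traceCLM d (fderiv ℝ w x))
      ((traceCLM d).continuous.comp (hw.continuous_fderiv one_ne_zero)) hK hxK
  have hyO : (fun p : ℝ × (Fin d → ℝ) => ψ p.1 p.2 - p.2) =O[l] fun p => p.1 := by
    have := htO.smul hwO
    simp only [smul_eq_mul, mul_one] at this
    simpa using hy.isBigO.add this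
  have hu1 := (isLittleO_sub_sub_fderiv_of_isCompact hu hK hxK
    (hyO.trans_tendsto ht0)).trans_isBigO hyO
  have hu2 : (fun p : ℝ × (Fin d → ℝ) => fderiv ℝ u p.2 (ψ p.1 p.2 - p.2 - p.1 • w p.2))
      =o[l] fun p => p.1 := by
    have : (fun p : ℝ × (Fin d → ℝ) => fderiv ℝ u p.2 (ψ p.1 p.2 - p.2 - p.1 • w p.2))
        =O[l] fun p => ‖fderiv ℝ u p.2‖ * ‖ψ p.1 p.2 - p.2 - p.1 • w p.2‖ :=
      Asymptotics.isBigO_of_le _ fun p => by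
        rw [norm_mul, norm_norm, norm_norm]
        exact (fderiv ℝ u p.2).le_opNorm _
    exact this.trans_isLittleO (by simpa using hDuO.norm_left.mul_isLittleO hy.norm_left)
  have hu3 := hu1.add hu2
  have hJ1O : (fun p : ℝ × (Fin d → ℝ) => (fderiv ℝ (ψ p.1) p.2).det - 1) =O[l]
      fun p => p.1 := by
    have := htO.mul htrO
    simp only [mul_one] at this
    simpa using hJ.isBigO.add this
  have hJ0 := hJ1O.trans_tendsto ht0
  have hJlim : Tendsto (fun p : ℝ × (Fin d → ℝ) => (fderiv ℝ (ψ p.1) p.2).det) l (𝓝 1) := by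
    simpa using hJ0.add_const 1
  have e1 := hu3.mul_isBigO (hJlim.isBigO_one ℝ)
  have e2 := huO.mul_isLittleO hJ
  have e3 := (htO.mul hDuwO).mul_isLittleO ((Asymptotics.isLittleO_one_iff ℝ).2 hJ0)
  simp only [mul_one, one_mul] at e1 e2 e3
  refine ((e1.add e2).add e3).congr' ?_ EventuallyEq.rfl
  filter_upwards [hJlim.eventually_const_lt one_pos] with p hp
  rw [abs_of_pos hp, divVU_eq (hw.differentiable one_ne_zero _) (hu.differentiable one_ne_zero _),
    ← traceCLM_apply]
  simp only [map_sub, map_smul, smul_eq_mul]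
  ring

/-- Near points whose short trajectory leaves `interior K`, a `C¹` density supported in `K` and
the divergence of its flux are negligible. -/
theorem isLittleO_outflow (hw : ContDiff ℝ 1 w) (h0 : ∀ x, ψ 0 x = x)
    (hψ : ∀ x t, HasDerivAt (fun τ => ψ τ x) (w (ψ t x)) t) (hK : IsCompact K)
    (hu : ContDiff ℝ 1 u) (hsupp : tsupport u ⊆ K) :
    (fun p : ℝ × (Fin d → ℝ) => 0 - u p.2 - p.1 * divVU w u p.2)
      =o[(𝓝[>] 0 ×ˢ 𝓟 K) ⊓ 𝓟 {p | ¬ ∀ s ∈ Icc 0 p.1, ψ s p.2 ∈ interior K}] fun p => p.1 := by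
  have hDu := hu.continuous_fderiv one_ne_zero
  have hu0 : ∀ z ∉ interior K, u z = 0 := fun z hz => by
    by_contra h
    exact hz (interior_maximal ((subset_tsupport u).trans hsupp)
      hu.continuous.isOpen_support h)
  have hDu0 : ∀ z ∉ interior K, fderiv ℝ u z = 0 := fun z hz => by
    by_contra h
    exact hz (interior_maximal ((support_fderiv_subset ℝ).trans hsupp) hDu.isOpen_support h)
  obtain ⟨C, hC, hflow⟩ := eventually_norm_flow_sub_le hw.continuous h0 hψ hK
  set l : Filter (ℝ × (Fin d → ℝ)) :=
    (𝓝[>] 0 ×ˢ 𝓟 K) ⊓ 𝓟 {p | ¬ ∀ s ∈ Icc 0 p.1, ψ s p.2 ∈ interior K}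
  have hbad : ∀ᶠ p in l, ¬ ∀ s ∈ Icc 0 p.1, ψ s p.2 ∈ interior K :=
    mem_inf_of_right (mem_principal_self _)
  have hxK : ∀ᶠ p in l, p.2 ∈ K :=
    (eventually_snd_mem_prod_principal (𝓝[>] (0 : ℝ)) K).filter_mono inf_le_left
  have ht0 : Tendsto (fun p : ℝ × (Fin d → ℝ) => p.1) l (𝓝 0) :=
    (tendsto_fst_nhdsGT_prod_principal K).mono_left inf_le_left
  have hex : ∀ p : ℝ × (Fin d → ℝ), ∃ s, (¬ ∀ s ∈ Icc 0 p.1, ψ s p.2 ∈ interior K) →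
      s ∈ Icc 0 p.1 ∧ ψ s p.2 ∉ interior K := fun p => by
    by_cases h : ∀ s ∈ Icc 0 p.1, ψ s p.2 ∈ interior K
    · exact ⟨0, fun h' => absurd h h'⟩
    · push Not at h
      obtain ⟨s, hs⟩ := h
      exact ⟨s, fun _ => hs⟩
  choose s hs using hex
  have hzO : (fun p : ℝ × (Fin d → ℝ) => ψ (s p) p.2 - p.2) =O[l] fun p => p.1 := by
    refine Asymptotics.IsBigO.of_bound C ?_
    filter_upwards [hbad, hflow.filter_mono inf_le_left] with p hp hfl
    exact (hfl _ (hs p hp).1).trans (mul_le_mul_of_nonneg_left (le_abs_self _) hC.le)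
  have hz0 := hzO.trans_tendsto ht0
  have hDuo : (fun p : ℝ × (Fin d → ℝ) => fderiv ℝ u p.2) =o[l] fun _ => (1 : ℝ) := by
    refine (Asymptotics.isLittleO_one_iff ℝ).2 ?_
    have := (tendsto_sub_of_isCompact hDu hK hxK hz0).neg
    rw [neg_zero] at this
    refine this.congr' ?_
    filter_upwards [hbad] with p hp
    simp [hDu0 _ (hs p hp).2]
  have happly : ∀ g : ℝ × (Fin d → ℝ) → (Fin d → ℝ),
      (fun p : ℝ × (Fin d → ℝ) => fderiv ℝ u p.2 (g p)) =O[l]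
        fun p => ‖fderiv ℝ u p.2‖ * ‖g p‖ := fun g =>
    Asymptotics.isBigO_of_le _ fun p => by simpa using (fderiv ℝ u p.2).le_opNorm _
  have hDuz : (fun p : ℝ × (Fin d → ℝ) => fderiv ℝ u p.2 (ψ (s p) p.2 - p.2)) =o[l]
      fun p => p.1 :=
    (happly _).trans_isLittleO (by simpa using hDuo.norm_left.mul_isBigO hzO.norm_left)
  have huo : (fun p : ℝ × (Fin d → ℝ) => 0 - u p.2) =o[l] fun p => p.1 := by
    have := ((isLittleO_sub_sub_fderiv_of_isCompact hu hK hxK hz0).trans_isBigO hzO).add hDuz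
    refine this.congr' ?_ EventuallyEq.rfl
    filter_upwards [hbad] with p hp
    simp [hu0 _ (hs p hp).2]
  have hDuw : (fun p : ℝ × (Fin d → ℝ) => fderiv ℝ u p.2 (w p.2)) =o[l] fun _ => (1 : ℝ) :=
    (happly _).trans_isLittleO (by
      simpa using hDuo.norm_left.mul_isBigO
        (isBigO_one_of_isCompact hw.continuous hK hxK).norm_left)
  have htrO : (fun p : ℝ × (Fin d → ℝ) => traceCLM d (fderiv ℝ w p.2)) =O[l]
      fun _ => (1 : ℝ) :=
    isBigO_one_of_isCompact (f := fun x => traceCLM d (fderiv ℝ w x))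
      ((traceCLM d).continuous.comp (hw.continuous_fderiv one_ne_zero)) hK hxK
  have hu1 : (fun p : ℝ × (Fin d → ℝ) => u p.2) =o[l] fun _ => (1 : ℝ) :=
    (Asymptotics.isLittleO_one_iff ℝ).2 (by simpa using (huo.isBigO.trans_tendsto ht0).neg)
  have hdiv : (fun p : ℝ × (Fin d → ℝ) => divVU w u p.2) =o[l] fun _ => (1 : ℝ) := by
    have := (hu1.mul_isBigO htrO).add (by simpa using hDuw)
    simp only [mul_one] at this
    refine this.congr_left fun p => ?_
    rw [divVU_eq (hw.differentiable one_ne_zero _) (hu.differentiable one_ne_zero _),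
      ← traceCLM_apply]
  have htdiv := (Asymptotics.isBigO_refl (fun p : ℝ × (Fin d → ℝ) => p.1) l).mul_isLittleO hdiv
  simp only [mul_one] at htdiv
  exact huo.sub htdiv

end Transport

/-- First-order expansion in time of the transfer operator, uniformly on the state space. -/
theorem FlowSetup.isLittleO_FP {d : ℕ} (S : FlowSetup d) {u : (Fin d → ℝ) → ℝ}
    (hu : ContDiff ℝ 1 u) (hsupp : tsupport u ⊆ S.X) :
    (fun p : ℝ × (Fin d → ℝ) => FP S.φ S.X p.1 u p.2 - u p.2 + p.1 * divVU S.v u p.2)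
      =o[𝓝[>] 0 ×ˢ 𝓟 S.X] fun p => p.1 := by
  have hv : ContDiff ℝ 1 S.v := S.hv.of_le one_le_two
  have hw : ContDiff ℝ 1 (-S.v) := hv.neg
  have h0 : ∀ x, S.φ (-0) x = x := by simpa using S.flow_zero
  have hψ : ∀ x t, HasDerivAt (fun τ => S.φ (-τ) x) ((-S.v) (S.φ (-t) x)) t := fun x t => by
    simpa [Function.comp_def] using (S.flow_deriv x (-t)).scomp t (hasDerivAt_neg t)
  have hdiv : ∀ x, divVU (-S.v) u x = -divVU S.v u x := fun x => by
    have hvx := hv.differentiable one_ne_zero x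
    have hux := hu.differentiable one_ne_zero x
    rw [divVU_eq hvx.neg hux, divVU_eq hvx hux, fderiv_neg]
    simp
    ring
  have hin := isLittleO_transport (ψ := fun t => S.φ (-t)) hw h0 hψ
    (fun t => (S.flow_smooth (-t)).differentiable one_ne_zero) S.hXcomp hu
  have hout := isLittleO_outflow (ψ := fun t => S.φ (-t)) hw h0 hψ S.hXcomp hu hsupp
  simp only [hdiv, mul_neg, sub_neg_eq_add] at hin hout
  refine Asymptotics.isLittleO_iff.2 fun ε hε => ?_
  filter_upwards [Asymptotics.isLittleO_iff.1 hin hε,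
    eventually_inf_principal.1 (Asymptotics.isLittleO_iff.1 hout hε)] with p hp1 hp2
  rw [FP]
  split_ifs with h
  · exact hp1
  · exact hp2 h

/-- for every `u ∈ C¹(ℝ^d)` with `supp u ⊆ X`, the restriction `u|_X` lies in
the domain of the generator `G̃` of `(P̃^t)_{t ≥ 0}` and `G̃ (u|_X) = (−div(v u))|_X`:
`(P̃^t u − u)/t → −div(v u)` in `L¹(X)` as `t → 0⁺`. -/
theorem FP_generator_on_C1_supported {d : ℕ} (S : FlowSetup d)
    (u : (Fin d → ℝ) → ℝ) (hu : ContDiff ℝ 1 u) (hsupp : tsupport u ⊆ S.X) :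
    Tendsto (fun t : ℝ =>
        ∫⁻ x in S.X, ‖(FP S.φ S.X t u x - u x) / t - (-(divVU S.v u x))‖₊ ∂volume)
      (𝓝[>] (0 : ℝ)) (𝓝 0) := by
  refine ENNReal.tendsto_nhds_zero.2 fun ε hε => ?_
  obtain ⟨δ, hδ, hδε⟩ := ENNReal.exists_nnreal_pos_mul_lt (S.hXcomp.measure_ne_top (μ := volume)) hε.ne'
  have h := eventually_prod_principal_iff.1
    (Asymptotics.isLittleO_iff.1 (S.isLittleO_FP hu hsupp) (NNReal.coe_pos.2 hδ))
  filter_upwards [h, self_mem_nhdsWithin] with t ht ht0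
  rw [mem_Ioi] at ht0
  refine le_trans ?_ hδε.le
  rw [← setLIntegral_const]
  refine setLIntegral_mono' S.hXcomp.measurableSet fun x hx => ?_
  rw [ENNReal.coe_le_coe, ← NNReal.coe_le_coe, coe_nnnorm,
    show (FP S.φ S.X t u x - u x) / t - -divVU S.v u x =
      (FP S.φ S.X t u x - u x + t * divVU S.v u x) / t by field_simp; ring,
    norm_div, div_le_iff₀ (norm_pos_iff.2 ht0.ne')]
  exact ht x hx
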